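/- arXiv:0904.3274 — 2 statements merged into one kernel-verified Lean document; each statement's English description precedes it below -/
import Mathlib

section
/- Let b ∈ ℝ, c ≥ 0 and let ν be a Lévy measure. Then the function ψ̂(u) = (b + c/2)u + (c/2)u² + ∫ (e^{u(eˣ−1)} − 1 − u·h(x)) dν(x) is infinitely differentiable on the interior of D = {u ∈ ℝ : ∫_{x>1} e^{u(eˣ−1)} dν(x) < ∞}. -/
open MeasureTheory Filter Set
open scoped ENNReal

/-- The truncation function `h(x) = x · 1_{|x| ≤ 1}`. -/
noncomputable def htrunc (x : ℝ) : ℝ := if |x| ≤ 1 then x else 0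

/-- The set `D = {u ∈ ℝ : ∫_{x>1} e^{u(eˣ-1)} dν(x) < ∞}`. -/
def Dset (ν : Measure ℝ) : Set ℝ :=
  {u : ℝ |
    ∫⁻ x in Set.Ioi (1 : ℝ), ENNReal.ofReal (Real.exp (u * (Real.exp x - 1))) ∂ν < ⊤}

/-- The Laplace exponent `ψ̂(u) = (b + c/2)u + (c/2)u² + ∫ (e^{u(eˣ-1)} - 1 - u h(x)) dν(x)`. -/
noncomputable def psihat (b c : ℝ) (ν : Measure ℝ) (u : ℝ) : ℝ :=
  (b + c / 2) * u + c / 2 * u ^ 2 +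
    ∫ x, (Real.exp (u * (Real.exp x - 1)) - 1 - u * htrunc x) ∂ν

open ProbabilityTheory

lemma abs_exp_sub_one_le_mul_exp (x : ℝ) : |Real.exp x - 1| ≤ |x| * Real.exp |x| := by
  have h := Complex.norm_exp_sub_sum_le_norm_mul_exp (x : ℂ) 1
  simp only [Finset.sum_range_one, pow_zero, Nat.factorial_zero, Nat.cast_one, div_one, pow_one,
    Complex.norm_real, Real.norm_eq_abs] at h
  rw [← Real.norm_eq_abs, ← Complex.norm_real]
  exact_mod_cast h

lemma abs_exp_sub_one_sub_le_sq_mul_exp (x : ℝ) :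
    |Real.exp x - 1 - x| ≤ x ^ 2 * Real.exp |x| := by
  have h := Complex.norm_exp_sub_sum_le_norm_mul_exp (x : ℂ) 2
  simp only [Finset.sum_range_succ, Finset.sum_range_zero, zero_add, pow_zero, Nat.factorial_zero,
    Nat.cast_one, div_one, pow_one, Nat.factorial_one, Complex.norm_real, Real.norm_eq_abs,
    sq_abs] at h
  rw [← sub_sub] at h
  rw [← Real.norm_eq_abs, ← Complex.norm_real]
  exact_mod_cast h

section BoundedExponent

variable {Ω : Type*} {mΩ : MeasurableSpace Ω} {μ : Measure Ω} {Y : Ω → ℝ} {C : ℝ}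

lemma contDiff_mgf_withDensity_sq (hY : Measurable Y) (hC : ∀ᵐ ω ∂μ, |Y ω| ≤ C)
    (hint : Integrable (fun ω ↦ Y ω ^ 2) μ) :
    ContDiff ℝ (⊤ : ℕ∞) (fun u ↦ ∫ ω, Y ω ^ 2 * Real.exp (u * Y ω) ∂μ) := by
  set κ := μ.withDensity fun ω ↦ ENNReal.ofReal (Y ω ^ 2) with hκ
  have : IsFiniteMeasure κ := isFiniteMeasure_withDensity_ofReal hint.2
  have hset : integrableExpSet Y κ = Set.univ := by
    refine Set.eq_univ_of_forall fun u ↦ ?_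
    refine integrable_exp_mul_of_mem_Icc (a := -C) (b := C) hY.aemeasurable ?_
    filter_upwards [(withDensity_absolutelyContinuous μ _).ae_le hC] with ω hω
    exact abs_le.mp hω
  have han : AnalyticOnNhd ℝ (mgf Y κ) Set.univ := by
    simpa [hset] using analyticOnNhd_mgf (X := Y) (μ := κ)
  have heq : mgf Y κ = fun u ↦ ∫ ω, Y ω ^ 2 * Real.exp (u * Y ω) ∂μ := by
    ext u
    rw [mgf, hκ, integral_withDensity_eq_integral_toReal_smul (by fun_prop) (by simp)]
    simp [ENNReal.toReal_ofReal (sq_nonneg _)]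
  rw [← heq, ← contDiffOn_univ]
  exact han.contDiffOn uniqueDiffOn_univ

lemma abs_mul_le_of_mem_ball {u v y : ℝ} (hu : u ∈ Metric.ball v 1) (hy : |y| ≤ C) :
    |u * y| ≤ (|v| + 1) * C := by
  rw [abs_mul]
  have h1 : |u| ≤ |v| + 1 := by
    have h := abs_sub_abs_le_abs_sub u v
    rw [Metric.mem_ball, Real.dist_eq] at hu
    linarith
  gcongr

lemma integrable_exp_sub_one_sub (hY : Measurable Y) (hC : ∀ᵐ ω ∂μ, |Y ω| ≤ C)
    (hint : Integrable (fun ω ↦ Y ω ^ 2) μ) (u : ℝ) :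
    Integrable (fun ω ↦ Real.exp (u * Y ω) - 1 - u * Y ω) μ := by
  refine (hint.mul_const (u ^ 2 * Real.exp (|u| * C))).mono' (by fun_prop) ?_
  filter_upwards [hC] with ω hω
  refine (abs_exp_sub_one_sub_le_sq_mul_exp _).trans ?_
  rw [mul_pow, abs_mul, mul_comm (u ^ 2), mul_assoc]
  gcongr

lemma abs_mul_exp_sub_one_le {u v y : ℝ} (hu : u ∈ Metric.ball v 1) (hy : |y| ≤ C) :
    |y * (Real.exp (u * y) - 1)| ≤ y ^ 2 * ((|v| + 1) * Real.exp ((|v| + 1) * C)) := by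
  have h1 : |u * y| ≤ (|v| + 1) * |y| := abs_mul_le_of_mem_ball hu le_rfl
  calc |y * (Real.exp (u * y) - 1)| ≤ |y| * (|u * y| * Real.exp |u * y|) := by
        rw [abs_mul]
        gcongr
        exact abs_exp_sub_one_le_mul_exp _
    _ ≤ |y| * (((|v| + 1) * |y|) * Real.exp ((|v| + 1) * C)) := by
        have h2 := abs_mul_le_of_mem_ball hu hy
        gcongr
    _ = y ^ 2 * ((|v| + 1) * Real.exp ((|v| + 1) * C)) := by
        rw [← sq_abs y]; ring

lemma hasDerivAt_integral_exp_sub_one_sub (hY : Measurable Y) (hC : ∀ᵐ ω ∂μ, |Y ω| ≤ C)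
    (hint : Integrable (fun ω ↦ Y ω ^ 2) μ) (v : ℝ) :
    Integrable (fun ω ↦ Y ω * (Real.exp (v * Y ω) - 1)) μ ∧
      HasDerivAt (fun u ↦ ∫ ω, (Real.exp (u * Y ω) - 1 - u * Y ω) ∂μ)
        (∫ ω, Y ω * (Real.exp (v * Y ω) - 1) ∂μ) v := by
  refine hasDerivAt_integral_of_dominated_loc_of_deriv_le (Metric.ball_mem_nhds v one_pos)
    (F' := fun u ω ↦ Y ω * (Real.exp (u * Y ω) - 1))
    (.of_forall fun u ↦ by fun_prop) (integrable_exp_sub_one_sub hY hC hint v) (by fun_prop)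
    ?_ (hint.mul_const ((|v| + 1) * Real.exp ((|v| + 1) * C))) (.of_forall fun ω u _ ↦ ?_)
  · filter_upwards [hC] with ω hω u hu using abs_mul_exp_sub_one_le hu hω
  · have h : HasDerivAt (fun u ↦ u * Y ω) (Y ω) u := hasDerivAt_mul_const (Y ω)
    exact ((h.exp.sub_const 1).fun_sub h).congr_deriv (by ring)

lemma hasDerivAt_integral_mul_exp_sub_one (hY : Measurable Y) (hC : ∀ᵐ ω ∂μ, |Y ω| ≤ C)
    (hint : Integrable (fun ω ↦ Y ω ^ 2) μ) (v : ℝ) :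
    HasDerivAt (fun u ↦ ∫ ω, Y ω * (Real.exp (u * Y ω) - 1) ∂μ)
      (∫ ω, Y ω ^ 2 * Real.exp (v * Y ω) ∂μ) v := by
  refine (hasDerivAt_integral_of_dominated_loc_of_deriv_le (Metric.ball_mem_nhds v one_pos)
    (F' := fun u ω ↦ Y ω ^ 2 * Real.exp (u * Y ω))
    (.of_forall fun u ↦ by fun_prop) (hasDerivAt_integral_exp_sub_one_sub hY hC hint v).1
    (by fun_prop) ?_ (hint.mul_const (Real.exp ((|v| + 1) * C))) (.of_forall fun ω u _ ↦ ?_)).2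
  · filter_upwards [hC] with ω hω u hu
    rw [Real.norm_eq_abs, abs_mul, abs_of_nonneg (sq_nonneg _), Real.abs_exp]
    exact mul_le_mul_of_nonneg_left (Real.exp_le_exp.mpr
      ((le_abs_self _).trans (abs_mul_le_of_mem_ball hu hω))) (sq_nonneg _)
  · have h : HasDerivAt (fun u ↦ u * Y ω) (Y ω) u := hasDerivAt_mul_const (Y ω)
    exact ((h.exp.sub_const 1).const_mul (Y ω)).congr_deriv (by ring)

/-- The compensated exponential integral of a bounded, square-integrable exponent is smooth. -/
lemma contDiff_integral_exp_sub_one_sub (hY : Measurable Y) (hC : ∀ᵐ ω ∂μ, |Y ω| ≤ C)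
    (hint : Integrable (fun ω ↦ Y ω ^ 2) μ) :
    ContDiff ℝ (⊤ : ℕ∞) (fun u ↦ ∫ ω, (Real.exp (u * Y ω) - 1 - u * Y ω) ∂μ) := by
  have h1 v := (hasDerivAt_integral_exp_sub_one_sub hY hC hint v).2
  have h2 := hasDerivAt_integral_mul_exp_sub_one hY hC hint
  rw [contDiff_infty_iff_deriv, funext fun v ↦ (h1 v).deriv, contDiff_infty_iff_deriv,
    funext fun v ↦ (h2 v).deriv]
  exact ⟨fun v ↦ (h1 v).differentiableAt, fun v ↦ (h2 v).differentiableAt,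
    contDiff_mgf_withDensity_sq hY hC hint⟩

end BoundedExponent

lemma exp_sub_one_sq_le {x : ℝ} (hx : x ≤ 1) : (Real.exp x - 1) ^ 2 ≤ 4 * min (x ^ 2) 1 := by
  rcases le_or_gt (-1) x with h | h
  · have h1 := Real.abs_exp_sub_one_le (abs_le.mpr ⟨h, hx⟩)
    have h2 : x ^ 2 ≤ 1 := by nlinarith
    rw [min_eq_left h2, ← sq_abs, ← sq_abs x]
    nlinarith [abs_nonneg (Real.exp x - 1)]
  · have h1 : Real.exp x < 1 := Real.exp_lt_one_iff.mpr (by linarith)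
    rw [min_eq_right (by nlinarith)]
    nlinarith [Real.exp_pos x]

lemma abs_exp_sub_one_sub_htrunc_le {x : ℝ} (hx : x ≤ 1) :
    |Real.exp x - 1 - htrunc x| ≤ min (x ^ 2) 1 := by
  rcases le_or_gt (-1) x with h | h
  · have hx' := abs_le.mpr ⟨h, hx⟩
    rw [htrunc, if_pos hx', min_eq_left (by nlinarith)]
    exact Real.abs_exp_sub_one_sub_id_le hx'
  · have h1 : Real.exp x < 1 := Real.exp_lt_one_iff.mpr (by linarith)
    rw [htrunc, if_neg (by rw [abs_le]; intro h'; linarith), min_eq_right (by nlinarith), abs_le]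
    constructor <;> linarith [Real.exp_pos x]

lemma measurable_htrunc : Measurable htrunc :=
  Measurable.ite (measurableSet_le (by fun_prop) (by fun_prop)) measurable_id measurable_const

lemma Dset_eq_integrableExpSet (ν : Measure ℝ) :
    Dset ν = integrableExpSet (fun x ↦ Real.exp x - 1) (ν.restrict (Set.Ioi 1)) := by
  ext u
  rw [Dset, integrableExpSet, Set.mem_ofPred_eq, Set.mem_ofPred_eq, Integrable,
    hasFiniteIntegral_iff_ofReal (.of_forall fun _ ↦ (Real.exp_pos _).le)]
  exact ⟨fun h ↦ ⟨by fun_prop, h⟩, fun h ↦ h.2⟩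

/-- smoothness part of Lemma 6: `ψ̂` is `C^∞` on the interior of `D`. -/
theorem stmt_3 (b c : ℝ) (hc : 0 ≤ c) (ν : Measure ℝ)
    (hν0 : ν {0} = 0)
    (hν : ∫⁻ x, ENNReal.ofReal (min (x ^ 2) 1) ∂ν < ⊤) :
    ContDiffOn ℝ (⊤ : ℕ∞) (psihat b c ν) (interior (Dset ν)) := by
  have hmin : Integrable (fun x : ℝ ↦ min (x ^ 2) 1) ν :=
    ⟨by fun_prop, (hasFiniteIntegral_iff_ofReal (.of_forall fun x ↦ by positivity)).mpr hν⟩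
  have hle : ∀ᵐ x ∂ν.restrict (Set.Iic (1 : ℝ)), x ≤ 1 := ae_restrict_mem measurableSet_Iic
  have hY : Measurable fun x : ℝ ↦ Real.exp x - 1 := by fun_prop
  have hC : ∀ᵐ x ∂ν.restrict (Set.Iic (1 : ℝ)), |Real.exp x - 1| ≤ 2 := by
    filter_upwards [hle] with x hx
    refine abs_le_of_sq_le_sq ((exp_sub_one_sq_le hx).trans ?_) (by norm_num)
    linarith [min_le_right (x ^ 2) 1]
  have hsq : Integrable (fun x ↦ (Real.exp x - 1) ^ 2) (ν.restrict (Set.Iic 1)) := by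
    refine (hmin.restrict.const_mul 4).mono' (by fun_prop) ?_
    filter_upwards [hle] with x hx
    rw [Real.norm_eq_abs, abs_of_nonneg (sq_nonneg _)]
    exact exp_sub_one_sq_le hx
  have hcomp : Integrable (fun x ↦ Real.exp x - 1 - htrunc x) (ν.restrict (Set.Iic 1)) := by
    refine hmin.restrict.mono' (hY.sub measurable_htrunc).aestronglyMeasurable ?_
    filter_upwards [hle] with x hx using abs_exp_sub_one_sub_htrunc_le hx
  have hone : Integrable (fun _ ↦ (1 : ℝ)) (ν.restrict (Set.Ioi 1)) := by
    refine hmin.restrict.congr ?_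
    filter_upwards [ae_restrict_mem measurableSet_Ioi] with x (hx : 1 < x)
    exact min_eq_right (by nlinarith)
  have hsmall (u : ℝ) : (fun x ↦ Real.exp (u * (Real.exp x - 1)) - 1 - u * htrunc x) =
      fun x ↦ (Real.exp (u * (Real.exp x - 1)) - 1 - u * (Real.exp x - 1)) +
        u * (Real.exp x - 1 - htrunc x) := by
    ext x; ring
  have hlarge (u : ℝ) : (fun x ↦ Real.exp (u * (Real.exp x - 1)) - 1 - u * htrunc x)
      =ᵐ[ν.restrict (Set.Ioi 1)] fun x ↦ Real.exp (u * (Real.exp x - 1)) - 1 := by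
    filter_upwards [ae_restrict_mem measurableSet_Ioi] with x (hx : 1 < x)
    rw [htrunc, if_neg (by rw [abs_le]; intro h; linarith)]
    ring
  have hexp := integrable_exp_sub_one_sub hY hC hsq
  rw [Dset_eq_integrableExpSet]
  have hmgf : ContDiffOn ℝ (⊤ : ℕ∞)
      (mgf (fun x ↦ Real.exp x - 1) (ν.restrict (Set.Ioi 1)))
      (interior (integrableExpSet (fun x ↦ Real.exp x - 1) (ν.restrict (Set.Ioi 1)))) :=
    analyticOnNhd_mgf.contDiffOn isOpen_interior.uniqueDiffOn
  have hpoly : ContDiff ℝ (⊤ : ℕ∞) (fun u : ℝ ↦ (b + c / 2) * u + c / 2 * u ^ 2) := by fun_prop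
  have hlin : ContDiff ℝ (⊤ : ℕ∞)
      (fun u : ℝ ↦ u * ∫ x in Set.Iic 1, (Real.exp x - 1 - htrunc x) ∂ν) := by fun_prop
  refine (hpoly.contDiffOn.add (((contDiff_integral_exp_sub_one_sub hY hC hsq).add
    hlin).contDiffOn.add (hmgf.sub
      (contDiffOn_const (c := ∫ x in Set.Ioi 1, (1 : ℝ) ∂ν))))).congr fun u hu ↦ ?_
  have hu' := integrable_of_mem_integrableExpSet (interior_subset hu)
  have hI : IntegrableOn (fun x ↦ Real.exp (u * (Real.exp x - 1)) - 1 - u * htrunc x)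
      (Set.Iic 1) ν := by
    rw [IntegrableOn, hsmall]
    exact (hexp u).add (hcomp.const_mul u)
  have hJ : IntegrableOn (fun x ↦ Real.exp (u * (Real.exp x - 1)) - 1 - u * htrunc x)
      (Set.Ioi 1) ν := (hu'.sub hone).congr (hlarge u).symm
  have hsplit := setIntegral_union (Set.Iic_disjoint_Ioi le_rfl) measurableSet_Ioi hI hJ
  rw [Set.Iic_union_Ioi, Measure.restrict_univ, integral_congr_ae (hlarge u),
    integral_sub hu' hone, hsmall, integral_add (hexp u) (hcomp.const_mul u),
    integral_const_mul, ← hsmall] at hsplit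
  rw [psihat, hsplit]
  rfl
end

section
/- Let ν be a Lévy measure and let Y : ℝ → [0,∞) be Borel measurable with ∫ min(x²,1)·Y(x) dν(x) < ∞. Suppose there is β ∈ ℝ such that Y(x) = 1 + βx + o(x) as x → 0, i.e. (Y(x) − 1 − βx)/x → 0 as x → 0. Then ∫ (√(Y(x)) − 1)² dν(x) < ∞. -/
open MeasureTheory Filter Set
open scoped ENNReal

theorem sq_sqrt_sub_one_le_sq_sub_one {y : ℝ} (hy : 0 ≤ y) :
    (√y - 1) ^ 2 ≤ (y - 1) ^ 2 := by
  have h : y - 1 = (√y - 1) * (√y + 1) := by linear_combination -(Real.sq_sqrt hy)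
  rw [h, mul_pow]
  exact le_mul_of_one_le_right (sq_nonneg _) (one_le_pow₀ (by linarith [Real.sqrt_nonneg y]))

theorem sq_sqrt_sub_one_le_one_add {y : ℝ} (hy : 0 ≤ y) : (√y - 1) ^ 2 ≤ 1 + y := by
  nlinarith [Real.sqrt_nonneg y, Real.sq_sqrt hy]

/-- A nonnegative function with a first-order expansion `1 + β x + o(x)` at `0` has
`(√Y - 1)²` dominated by a multiple of `min (x²) 1 * (1 + Y)` away from `0`. -/
theorem exists_sq_sqrt_sub_one_le_mul_min {Y : ℝ → ℝ} (hY : ∀ x, 0 ≤ Y x) {β : ℝ}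
    (ho : Tendsto (fun x => (Y x - 1 - β * x) / x) (nhdsWithin 0 {(0 : ℝ)}ᶜ) (nhds 0)) :
    ∃ C : ℝ, 0 ≤ C ∧ ∀ x ≠ 0,
      (√(Y x) - 1) ^ 2 ≤ C * (min (x ^ 2) 1 + min (x ^ 2) 1 * Y x) := by
  obtain ⟨δ, hδ, h⟩ := Metric.tendsto_nhdsWithin_nhds.1 ho 1 one_pos
  set r := min δ 1 with hr
  have hr0 : 0 < r := lt_min hδ one_pos
  refine ⟨(|β| + 1) ^ 2 + (r ^ 2)⁻¹, by positivity, fun x hx => ?_⟩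
  have hm : 0 ≤ min (x ^ 2) 1 := le_min (sq_nonneg x) zero_le_one
  have hmY : 0 ≤ min (x ^ 2) 1 * Y x := mul_nonneg hm (hY x)
  rw [add_mul]
  rcases lt_or_ge |x| r with hxr | hxr
  · have hq : |Y x - 1 - β * x| < |x| := by
      have := h (show x ∈ ({0} : Set ℝ)ᶜ from hx)
        (by simpa [Real.dist_eq] using hxr.trans_le (min_le_left _ _))
      rwa [Real.dist_eq, sub_zero, abs_div, div_lt_one (abs_pos.2 hx)] at this
    have hb : |Y x - 1| ≤ (|β| + 1) * |x| :=
      calc |Y x - 1| = |(Y x - 1 - β * x) + β * x| := by ring_nf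
        _ ≤ |Y x - 1 - β * x| + |β * x| := abs_add_le _ _
        _ ≤ (|β| + 1) * |x| := by rw [abs_mul]; linarith
    have hmin : min (x ^ 2) 1 = x ^ 2 :=
      min_eq_left ((sq_le_one_iff_abs_le_one x).2 (hxr.le.trans (min_le_right _ _)))
    calc (√(Y x) - 1) ^ 2 ≤ (Y x - 1) ^ 2 := sq_sqrt_sub_one_le_sq_sub_one (hY x)
      _ = |Y x - 1| ^ 2 := (sq_abs _).symm
      _ ≤ ((|β| + 1) * |x|) ^ 2 := by gcongr
      _ = (|β| + 1) ^ 2 * min (x ^ 2) 1 := by rw [mul_pow, sq_abs, hmin]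
      _ ≤ (|β| + 1) ^ 2 * (min (x ^ 2) 1 + min (x ^ 2) 1 * Y x) := by gcongr; linarith
      _ ≤ _ := le_add_of_nonneg_right (by positivity)
  · have hmin : r ^ 2 ≤ min (x ^ 2) 1 :=
      le_min (by rw [← sq_abs x]; gcongr) (pow_le_one₀ hr0.le (min_le_right _ _))
    calc (√(Y x) - 1) ^ 2 ≤ 1 + Y x := sq_sqrt_sub_one_le_one_add (hY x)
      _ = (r ^ 2)⁻¹ * (r ^ 2 * (1 + Y x)) := by field_simp
      _ ≤ (r ^ 2)⁻¹ * (min (x ^ 2) 1 * (1 + Y x)) := by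
        have := hY x
        gcongr
      _ = (r ^ 2)⁻¹ * (min (x ^ 2) 1 + min (x ^ 2) 1 * Y x) := by ring
      _ ≤ _ := le_add_of_nonneg_left (by positivity)

/-- if `Y ≥ 0` with `∫ min(x²,1) Y dν < ∞` and `Y(x) = 1 + βx + o(x)`
as `x → 0`, then `∫ (√Y - 1)² dν < ∞` (finiteness of the Hellinger process of
order 1/2). -/
theorem stmt_11 (ν : Measure ℝ)
    (hν0 : ν {0} = 0)
    (hν : ∫⁻ x, ENNReal.ofReal (min (x ^ 2) 1) ∂ν < ⊤)
    (Y : ℝ → ℝ) (hYmeas : Measurable Y) (hYnonneg : ∀ x, 0 ≤ Y x)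
    (hYν : ∫⁻ x, ENNReal.ofReal (min (x ^ 2) 1 * Y x) ∂ν < ⊤)
    (β : ℝ)
    (ho : Tendsto (fun x => (Y x - 1 - β * x) / x) (nhdsWithin 0 {(0 : ℝ)}ᶜ) (nhds 0)) :
    ∫⁻ x, ENNReal.ofReal ((Real.sqrt (Y x) - 1) ^ 2) ∂ν < ⊤ := by
  obtain ⟨C, hC, hbound⟩ := exists_sq_sqrt_sub_one_le_mul_min hYnonneg ho
  have hne : ∀ᵐ x ∂ν, x ≠ 0 := by simpa [ae_iff] using hν0
  calc ∫⁻ x, ENNReal.ofReal ((√(Y x) - 1) ^ 2) ∂ν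
      ≤ ∫⁻ x, ENNReal.ofReal C * (ENNReal.ofReal (min (x ^ 2) 1) +
          ENNReal.ofReal (min (x ^ 2) 1 * Y x)) ∂ν := by
        refine lintegral_mono_ae (hne.mono fun x hx => ?_)
        have hm : 0 ≤ min (x ^ 2) 1 := le_min (sq_nonneg x) zero_le_one
        rw [← ENNReal.ofReal_add hm (mul_nonneg hm (hYnonneg x)), ← ENNReal.ofReal_mul hC]
        exact ENNReal.ofReal_le_ofReal (hbound x hx)
    _ = ENNReal.ofReal C * (∫⁻ x, ENNReal.ofReal (min (x ^ 2) 1) ∂ν +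
          ∫⁻ x, ENNReal.ofReal (min (x ^ 2) 1 * Y x) ∂ν) := by
        rw [lintegral_const_mul' _ _ ENNReal.ofReal_ne_top, lintegral_add_left (by fun_prop)]
    _ < ⊤ := ENNReal.mul_lt_top ENNReal.ofReal_lt_top (ENNReal.add_lt_top.2 ⟨hν, hYν⟩)
end
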